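/- arXiv:1011.1557 — 2 statements merged into one kernel-verified Lean document; each statement's English description precedes it below -/
import Mathlib

section
/- Let m and n be natural numbers with m > 2 and n ≥ m − 1, and let X be a commutative semigroup variety with X ⊆ D_m. Then A_n ∨ X = A_n ∨ ZR(X). -/
open FirstOrder

/-! ### Words, identities, and commutative semigroup varieties -/

/-- Semigroup words over the countable alphabet `ℕ`. -/
abbrev SGWord : Type := FreeSemigroup ℕ

/-- A semigroup identity `u = v` is a pair of words. -/
abbrev SGId : Type := SGWord × SGWord

/-- The one-letter word consisting of the letter `n`. -/
def ltr (n : ℕ) : SGWord := FreeSemigroup.of n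

/-- `wpow w n` is the word `w^n` (for `n ≥ 1`; by convention `wpow w 0 = w`). -/
def wpow (w : SGWord) : ℕ → SGWord
  | 0 => w
  | 1 => w
  | n + 2 => wpow w (n + 1) * w

/-- The letter `n` occurs in the word `w`. -/
def OccursIn (n : ℕ) (w : SGWord) : Prop := n = w.head ∨ n ∈ w.tail

/-- A semigroup `S` satisfies the identity `i.1 = i.2` if all evaluations of the two
words in `S` coincide. -/
def SGSatisfies (S : Type) [Semigroup S] (i : SGId) : Prop :=
  ∀ f : ℕ → S, FreeSemigroup.lift f i.1 = FreeSemigroup.lift f i.2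

/-- A bundled (nonempty) commutative semigroup. -/
structure ComSG where
  carrier : Type
  [str : CommSemigroup carrier]
  [instNonempty : Nonempty carrier]

attribute [instance] ComSG.str ComSG.instNonempty

/-- The class of commutative semigroups satisfying every identity in `E`. -/
def modelsOf (E : Set SGId) : Set ComSG := {S | ∀ i ∈ E, SGSatisfies S.carrier i}

/-- The set of identities holding in every member of the class `K`. -/
def theoryOfClass (K : Set ComSG) : Set SGId := {i | ∀ S ∈ K, SGSatisfies S.carrier i}

theorem subset_theoryOfClass_modelsOf (E : Set SGId) : E ⊆ theoryOfClass (modelsOf E) :=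
  fun i hi S hS => hS i hi

theorem theoryOfClass_antitone {K K' : Set ComSG} (h : K ⊆ K') :
    theoryOfClass K' ⊆ theoryOfClass K := fun _ hi S hS => hi S (h hS)

theorem modelsOf_antitone {E E' : Set SGId} (h : E ⊆ E') : modelsOf E' ⊆ modelsOf E :=
  fun _ hS i hi => hS i (h hi)

/-- A variety of commutative semigroups, identified with its (equationally closed)
equational theory.  Varieties are ordered by inclusion of the corresponding classes
of semigroups, i.e. by *reverse* inclusion of theories. -/
structure ComVariety where
  theory : Set SGId
  closed : theoryOfClass (modelsOf theory) = theory

theorem ComVariety.ext' {V W : ComVariety} (h : V.theory = W.theory) : V = W := by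
  cases V; cases W; cases h; rfl

instance : PartialOrder ComVariety where
  le V W := W.theory ⊆ V.theory
  le_refl V := subset_rfl
  le_trans U V W h1 h2 := fun i hi => h1 (h2 hi)
  le_antisymm V W h1 h2 := ComVariety.ext' (subset_antisymm h2 h1)

instance : SupSet ComVariety where
  sSup s :=
    { theory := ⋂ V ∈ s, V.theory
      closed := by
        apply subset_antisymm
        · intro i hi
          refine Set.mem_iInter₂.2 fun V hV => ?_
          have h1 : (⋂ V ∈ s, ComVariety.theory V) ⊆ V.theory := Set.biInter_subset_of_mem hV
          have h2 := theoryOfClass_antitone (modelsOf_antitone h1)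
          rw [V.closed] at h2
          exact h2 hi
        · exact subset_theoryOfClass_modelsOf _ }

/-- The lattice **Com** of all commutative semigroup varieties. -/
instance : CompleteLattice ComVariety :=
  completeLatticeOfSup ComVariety fun s => by
    constructor
    · intro V hV i hi
      exact Set.mem_iInter₂.1 hi V hV
    · intro W hW i hi
      exact Set.mem_iInter₂.2 fun V hV => hW hV hi

/-- The variety of commutative semigroups given by the identity system `E`. -/
def comVar (E : Set SGId) : ComVariety where
  theory := theoryOfClass (modelsOf E)
  closed := by
    apply subset_antisymm
    · exact theoryOfClass_antitone fun S hS i hi => hi S hS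
    · exact subset_theoryOfClass_modelsOf _

/-! ### The first-order language of lattices and definability -/

/-- The first-order language of lattices: two binary function symbols (`true` for the
join `∨` and `false` for the meet `∧`) and nothing else. -/
def latticeLang : Language where
  Functions := fun n => match n with | 2 => Bool | _ => Empty
  Relations := fun _ => Empty

instance latticeLangStructure (L : Type*) [Lattice L] : latticeLang.Structure L where
  funMap {n} f x :=
    match n, f with
    | 2, b => bif b then x 0 ⊔ x 1 else x 0 ⊓ x 1
    | 0, f => f.elim
    | 1, f => f.elim
    | (_ + 3), f => f.elim
  RelMap {n} r _ := r.elim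

/-- A subset `A` of a lattice `L` is definable in `L` if there is a first-order formula
`φ(x)` with one free variable in the language of the lattice operations `∨` and `∧`
such that for every `a ∈ L`, `φ(a)` holds in `L` if and only if `a ∈ A`. -/
def LatDefinable (L : Type*) [Lattice L] (A : Set L) : Prop :=
  ∃ φ : latticeLang.Formula (Fin 1), ∀ a : L, (φ.Realize fun _ => a) ↔ a ∈ A

/-! ### Named varieties -/

/-- The commutativity identity `xy = yx`. -/
def commId : SGId := (ltr 0 * ltr 1, ltr 1 * ltr 0)

/-- The pair of identities abbreviated by the symbolic identity `w = 0`, namely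
`wx = w` and `xw = w`, where `x` is the letter `n` (assumed not to occur in `w`). -/
def zeroId (w : SGWord) (n : ℕ) : Set SGId := {(w * ltr n, w), (ltr n * w, w)}

/-- `A n = var{xⁿy = y, xy = yx}`, the variety of Abelian groups of exponent dividing `n`. -/
def Avar (n : ℕ) : ComVariety := comVar {(wpow (ltr 0) n * ltr 1, ltr 1), commId}

/-- `SL = var{x² = x, xy = yx}`, the variety of semilattices. -/
def SLvar : ComVariety := comVar {(wpow (ltr 0) 2, ltr 0), commId}

/-- `ZM = var{xy = 0}` (within **Com**), the variety of null semigroups. -/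
def ZMvar : ComVariety := comVar ({commId} ∪ zeroId (ltr 0 * ltr 1) 2)

/-- `T = var{x = y}`, the trivial variety. -/
def Tvar : ComVariety := comVar {(ltr 0, ltr 1)}

/-- `COM`, the variety of all commutative semigroups. -/
def COMvar : ComVariety := comVar {commId}

/-- `C m = var{xᵐ = xᵐ⁺¹, xy = yx}` (the variety generated by the cyclic monoid
`⟨a ∣ aᵐ = aᵐ⁺¹⟩`), with the convention `C 0 = T`. -/
def Cvar : ℕ → ComVariety
  | 0 => Tvar
  | m + 1 => comVar {(wpow (ltr 0) (m + 1), wpow (ltr 0) (m + 2)), commId}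

/-- `D m = var{xᵐ = 0, xy = yx}`. -/
def Dvar (m : ℕ) : ComVariety := comVar ({commId} ∪ zeroId (wpow (ltr 0) m) 1)

/-- The word `x₁x₂⋯x_k` (in the letters `0, 1, …, k-1`), for `k ≥ 1`. -/
def chainWord : ℕ → SGWord
  | 0 => ltr 0
  | 1 => ltr 0
  | k + 2 => chainWord (k + 1) * ltr (k + 1)

/-- `N k = var{x² = x₁x₂⋯x_k = 0, xy = yx}`. -/
def Nvar (k : ℕ) : ComVariety :=
  comVar ({commId} ∪ zeroId (wpow (ltr 0) 2) 1 ∪ zeroId (chainWord k) k)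

/-- `N_ω = var{x² = 0, xy = yx}`. -/
def Nomegavar : ComVariety := comVar ({commId} ∪ zeroId (wpow (ltr 0) 2) 1)

/-- `N₃ᶜ = var{xyz = 0, xy = yx}`. -/
def N3cvar : ComVariety := comVar ({commId} ∪ zeroId (ltr 0 * ltr 1 * ltr 2) 3)

/-! ### Semantic notions -/

/-- A semigroup `S` belongs to the variety `V` if it satisfies every identity of `V`. -/
def VMem (S : Type) [Semigroup S] (V : ComVariety) : Prop :=
  ∀ i ∈ V.theory, SGSatisfies S i

/-- `spow a n` is the power `aⁿ` in a semigroup (for `n ≥ 1`; by convention `spow a 0 = a`). -/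
def spow {S : Type} [Semigroup S] (a : S) : ℕ → S
  | 0 => a
  | 1 => a
  | n + 2 => spow a (n + 1) * a

/-- A semigroup is a group. -/
def IsGroupSG (S : Type) [Semigroup S] : Prop :=
  ∃ e : S, (∀ a, e * a = a ∧ a * e = a) ∧ ∀ a, ∃ b, a * b = e ∧ b * a = e

/-- A semigroup is periodic: every element generates a finite cyclic subsemigroup. -/
def IsPeriodicSG (S : Type) [Semigroup S] : Prop :=
  ∀ a : S, ∃ i j : ℕ, 1 ≤ i ∧ i < j ∧ spow a i = spow a j

/-- A semigroup is a nil-semigroup: it has a zero element and every element has a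
power equal to zero. -/
def IsNilSG (S : Type) [Semigroup S] : Prop :=
  ∃ z : S, (∀ a, z * a = z ∧ a * z = z) ∧ ∀ a, ∃ n, 1 ≤ n ∧ spow a n = z

/-- A variety all of whose members are groups. -/
def IsGroupVariety (V : ComVariety) : Prop := ∀ S ∈ modelsOf V.theory, IsGroupSG S.carrier

/-- A variety all of whose members are periodic semigroups. -/
def IsPeriodicVariety (V : ComVariety) : Prop := ∀ S ∈ modelsOf V.theory, IsPeriodicSG S.carrier

/-- A nil-variety: a variety all of whose members are nil-semigroups. -/
def IsNilVariety (V : ComVariety) : Prop := ∀ S ∈ modelsOf V.theory, IsNilSG S.carrier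

/-- A combinatorial variety: all groups in it are trivial. -/
def IsCombinatorial (V : ComVariety) : Prop :=
  ∀ S ∈ modelsOf V.theory, IsGroupSG S.carrier → ∀ a b : S.carrier, a = b

/-- `K` is the variety generated by the semigroup `M` (with explicit semigroup
structure `inst`): the smallest variety containing `M`. -/
def GeneratedBy (M : Type) (inst : Semigroup M) (K : ComVariety) : Prop :=
  IsLeast {W : ComVariety | ∀ i ∈ W.theory, @SGSatisfies M inst i} K

/-- A neutral element of a lattice. -/
def IsNeutralElt {α : Type*} [Lattice α] (x : α) : Prop :=
  ∀ y z, (x ⊔ y) ⊓ (y ⊔ z) ⊓ (z ⊔ x) = (x ⊓ y) ⊔ (y ⊓ z) ⊔ (z ⊓ x)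

/-- A chain variety: a variety whose lattice of subvarieties is a chain. -/
def IsChainVariety (V : ComVariety) : Prop :=
  ∀ W₁ W₂ : ComVariety, W₁ ≤ V → W₂ ≤ V → W₁ ≤ W₂ ∨ W₂ ≤ W₁

/-- A variety is 0-reduced in **Com** if it is given within `COM` by 0-reduced
identities (identities of the form `w = 0`) only. -/
def IsZeroReduced (V : ComVariety) : Prop :=
  ∃ P : Set (SGWord × ℕ), (∀ p ∈ P, ¬ OccursIn p.2 p.1) ∧
    V = comVar (⋃ p ∈ P, zeroId p.1 p.2)

/-- `ZR V`: the least variety 0-reduced in **Com** that contains `V`. -/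
def ZRv (V : ComVariety) : ComVariety := sInf {W : ComVariety | IsZeroReduced W ∧ V ≤ W}

/-- The list of letters of a word. -/
def SGWord.letters (w : SGWord) : List ℕ := w.head :: w.tail

theorem SGWord.letters_mul (u v : SGWord) : (u * v).letters = u.letters ++ v.letters := rfl

theorem occursIn_iff_mem_letters {k : ℕ} {w : SGWord} : OccursIn k w ↔ k ∈ w.letters := by
  simp [OccursIn, SGWord.letters]

theorem exists_not_occursIn (w : SGWord) : ∃ k, ¬ OccursIn k w := by
  obtain ⟨k, hk⟩ := Infinite.exists_notMem_finset w.letters.toFinset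
  exact ⟨k, fun h => hk (List.mem_toFinset.2 (occursIn_iff_mem_letters.1 h))⟩

theorem lift_eq_prod_letters {M : Type} [Monoid M] (f : ℕ → M) (w : SGWord) :
    FreeSemigroup.lift f w = (w.letters.map f).prod := by
  induction w using FreeSemigroup.recOnMul with
  | ih1 x => simp [SGWord.letters]
  | ih2 x y hx hy => rw [map_mul, hx, hy, SGWord.letters_mul, List.map_append, List.prod_append]

theorem coe_lift_eq_prod_letters {S : Type} [Semigroup S] (f : ℕ → S) (w : SGWord) :
    ((FreeSemigroup.lift f w : S) : WithOne S) =
      (w.letters.map fun i => (f i : WithOne S)).prod := by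
  rw [← lift_eq_prod_letters]
  induction w using FreeSemigroup.recOnMul with
  | ih1 x => simp
  | ih2 x y hx hy => rw [map_mul, map_mul, WithOne.coe_mul, hx, hy]

theorem letters_wpow_ltr (x : ℕ) {n : ℕ} (hn : 1 ≤ n) :
    (wpow (ltr x) n).letters = List.replicate n x := by
  induction n, hn using Nat.le_induction with
  | base => rfl
  | succ n hn ih =>
    obtain ⟨n, rfl⟩ : ∃ k, n = k + 1 := ⟨n - 1, by omega⟩
    rw [wpow, SGWord.letters_mul, ih, List.replicate_succ' (n := n + 1)]
    rfl

theorem lift_congr_of_letters {S : Type} [Semigroup S] {f g : ℕ → S} {w : SGWord}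
    (h : ∀ i ∈ w.letters, f i = g i) : FreeSemigroup.lift f w = FreeSemigroup.lift g w := by
  apply WithOne.coe_injective
  rw [coe_lift_eq_prod_letters, coe_lift_eq_prod_letters]
  congr 1
  exact List.map_congr_left fun i hi => by rw [h i hi]

theorem lift_eq_of_perm {S : Type} [CommSemigroup S] (f : ℕ → S) {u v : SGWord}
    (h : u.letters.Perm v.letters) : FreeSemigroup.lift f u = FreeSemigroup.lift f v := by
  apply WithOne.coe_injective
  rw [coe_lift_eq_prod_letters, coe_lift_eq_prod_letters]
  exact (h.map _).prod_eq

theorem eq_of_coe_dvd {S : Type} [CommSemigroup S] {z a : S} (hz : ∀ s, z * s = z)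
    (h : (z : WithOne S) ∣ a) : a = z := by
  obtain ⟨t, ht⟩ := h
  apply WithOne.coe_injective
  rw [ht]
  induction t using WithOne.recOneCoe with
  | one => rw [mul_one]
  | coe s => rw [← WithOne.coe_mul, hz]

theorem lift_eq_of_le_count {S : Type} [CommSemigroup S] {z : S} {m : ℕ} (hz : ∀ s, z * s = z)
    (hm : ∀ a : S, (a : WithOne S) ^ m = z) (f : ℕ → S) {w : SGWord} {x : ℕ}
    (hx : m ≤ w.letters.count x) : FreeSemigroup.lift f w = z := by
  apply eq_of_coe_dvd hz
  rw [coe_lift_eq_prod_letters, ← hm (f x)]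
  have h := (List.replicate_sublist_iff.2 hx).map fun i => (f i : WithOne S)
  simpa using h.prod_dvd_prod

theorem lift_eq_of_mem_letters {S : Type} [CommSemigroup S] {z : S} (hz : ∀ s, z * s = z)
    {f : ℕ → S} {w : SGWord} {x : ℕ} (hx : x ∈ w.letters) (hf : f x = z) :
    FreeSemigroup.lift f w = z := by
  apply eq_of_coe_dvd hz
  rw [coe_lift_eq_prod_letters, ← hf]
  exact List.dvd_prod (List.mem_map_of_mem hx)

theorem exists_zero_of_le_Dvar {m : ℕ} (hm : 1 ≤ m) {X : ComVariety} (hX : X ≤ Dvar m)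
    {S : ComSG} (hS : S ∈ modelsOf X.theory) :
    ∃ z : S.carrier, (∀ s, z * s = z) ∧ ∀ a : S.carrier, (a : WithOne S.carrier) ^ m = z := by
  have hsat : SGSatisfies S.carrier (wpow (ltr 0) m * ltr 1, wpow (ltr 0) m) :=
    hS _ (hX (subset_theoryOfClass_modelsOf _ (by simp [zeroId])))
  let p (a : S.carrier) : S.carrier := FreeSemigroup.lift (fun _ => a) (wpow (ltr 0) m)
  have hp (a b : S.carrier) : p a * b = p a := by
    have h := hsat fun i => if i = 0 then a else b
    have hc : FreeSemigroup.lift (fun i => if i = 0 then a else b) (wpow (ltr 0) m) = p a := by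
      apply lift_congr_of_letters
      intro i hi
      rw [letters_wpow_ltr 0 hm] at hi
      simp [List.eq_of_mem_replicate hi]
    dsimp only at h
    rw [map_mul, hc] at h
    simpa [ltr] using h
  have hpow (a : S.carrier) : (a : WithOne S.carrier) ^ m = p a := by
    simp [p, coe_lift_eq_prod_letters, letters_wpow_ltr 0 hm]
  obtain ⟨a⟩ := S.instNonempty
  refine ⟨p a, hp a, fun b => ?_⟩
  rw [hpow, ← hp b (p a), mul_comm, hp]

/-- If a variety inside `Dvar m` satisfies `u = v`, and some letter occurs at least `m` times
in `v`, or occurs in `v` but not in `u`, then the variety satisfies `u = 0`. -/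
theorem lift_mul_eq_of_count {m : ℕ} (hm : 1 ≤ m) {X : ComVariety} (hX : X ≤ Dvar m)
    {u v : SGWord} (huv : (u, v) ∈ X.theory) {x : ℕ}
    (hx : m ≤ v.letters.count x ∨ x ∉ u.letters ∧ x ∈ v.letters)
    {S : ComSG} (hS : S ∈ modelsOf X.theory) (f : ℕ → S.carrier) (s : S.carrier) :
    FreeSemigroup.lift f u * s = FreeSemigroup.lift f u := by
  obtain ⟨z, hz, hzm⟩ := exists_zero_of_le_Dvar hm hX hS
  suffices FreeSemigroup.lift f u = z by rw [this, hz]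
  rcases hx with hx | ⟨hu, hv⟩
  · exact (hS _ huv f).trans (lift_eq_of_le_count hz hzm f hx)
  · calc FreeSemigroup.lift f u = FreeSemigroup.lift (Function.update f x z) u :=
          lift_congr_of_letters fun i hi => by
            rw [Function.update_of_ne (by rintro rfl; exact hu hi)]
      _ = FreeSemigroup.lift (Function.update f x z) v := hS _ huv _
      _ = z := lift_eq_of_mem_letters hz hv (Function.update_self ..)

theorem count_modEq_of_mem_Avar {n : ℕ} (hn : 1 ≤ n) {u v : SGWord}
    (huv : (u, v) ∈ (Avar n).theory) (x : ℕ) :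
    u.letters.count x ≡ v.letters.count x [MOD n] := by
  rw [← ZMod.natCast_eq_natCast_iff]
  let G : ComSG := { carrier := Multiplicative (ZMod n) }
  have hG : G ∈ modelsOf {(wpow (ltr 0) n * ltr 1, ltr 1), commId} := by
    rintro i (rfl | rfl) (f : ℕ → Multiplicative (ZMod n))
    · change FreeSemigroup.lift f _ = FreeSemigroup.lift f _
      have h : f 0 ^ n = 1 := by
        apply Multiplicative.toAdd.injective
        simp
      rw [map_mul, lift_eq_prod_letters f (wpow _ _), letters_wpow_ltr 0 hn]
      simp [h]
    · change FreeSemigroup.lift f _ = FreeSemigroup.lift f _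
      rw [commId, map_mul, map_mul, mul_comm]
  have h (w : SGWord) : FreeSemigroup.lift
      (fun i => Multiplicative.ofAdd (if i = x then (1 : ZMod n) else 0)) w =
        Multiplicative.ofAdd (w.letters.count x : ZMod n) := by
    rw [lift_eq_prod_letters]
    induction w.letters with
    | nil => simp
    | cons a l ih =>
      rw [List.map_cons, List.prod_cons, ih, ← ofAdd_add, List.count_cons]
      by_cases hax : a = x <;> simp [hax, add_comm]
  have key := huv G hG
    (fun i => Multiplicative.ofAdd (if i = x then (1 : ZMod n) else 0) : ℕ → Multiplicative (ZMod n))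
  exact Multiplicative.ofAdd.injective ((h u).symm.trans (key.trans (h v)))

/-- The variety given by all 0-reduced identities of `X`. -/
def zeroReducedHull (X : ComVariety) : ComVariety :=
  comVar (⋃ p ∈ {p : SGWord × ℕ | ¬ OccursIn p.2 p.1 ∧ zeroId p.1 p.2 ⊆ X.theory}, zeroId p.1 p.2)

theorem ZRv_le_zeroReducedHull (X : ComVariety) : ZRv X ≤ zeroReducedHull X := by
  refine sInf_le ⟨⟨_, fun p hp => hp.1, rfl⟩, fun i hi => ?_⟩
  rw [← X.closed]
  exact theoryOfClass_antitone (modelsOf_antitone (Set.iUnion₂_subset fun p hp => hp.2)) hi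

theorem le_ZRv (X : ComVariety) : X ≤ ZRv X := le_sInf fun _ hW => hW.2

theorem lift_mul_eq_of_models_zeroReduced {X : ComVariety} {w : SGWord}
    (hw : ∀ S ∈ modelsOf X.theory, ∀ (f : ℕ → S.carrier) (s : S.carrier),
      FreeSemigroup.lift f w * s = FreeSemigroup.lift f w)
    {S : ComSG} (hS : S ∈ modelsOf
      (⋃ p ∈ {p : SGWord × ℕ | ¬ OccursIn p.2 p.1 ∧ zeroId p.1 p.2 ⊆ X.theory}, zeroId p.1 p.2))
    (f : ℕ → S.carrier) (s : S.carrier) :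
    FreeSemigroup.lift f w * s = FreeSemigroup.lift f w := by
  obtain ⟨k, hk⟩ := exists_not_occursIn w
  have hsub : zeroId w k ⊆ X.theory := by
    rw [← X.closed]
    rintro i (rfl | rfl) T hT g
    · dsimp only
      rw [map_mul, hw T hT]
    · dsimp only
      rw [map_mul, mul_comm, hw T hT]
  have h := hS (w * ltr k, w) (Set.mem_biUnion (x := (w, k)) ⟨hk, hsub⟩ (Or.inl rfl))
    (Function.update f k s)
  have hc : FreeSemigroup.lift (Function.update f k s) w = FreeSemigroup.lift f w :=
    lift_congr_of_letters fun i hi => by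
      rw [Function.update_of_ne]
      rintro rfl
      exact hk (occursIn_iff_mem_letters.2 hi)
  dsimp only at h
  rw [map_mul, hc] at h
  simpa [ltr] using h

theorem mem_zeroReducedHull_of_mem_of_mem_Avar {m n : ℕ} (hm : 2 < m) (hn : m - 1 ≤ n)
    {X : ComVariety} (hX : X ≤ Dvar m) {u v : SGWord} (hA : (u, v) ∈ (Avar n).theory)
    (huv : (u, v) ∈ X.theory) : (u, v) ∈ (zeroReducedHull X).theory := by
  intro S hS f
  by_cases hperm : u.letters.Perm v.letters
  · exact lift_eq_of_perm f hperm
  rw [List.perm_iff_count] at hperm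
  push Not at hperm
  obtain ⟨x, hx⟩ := hperm
  wlog hlt : u.letters.count x < v.letters.count x generalizing u v
  · refine (this (u := v) (v := u) ?_ ?_ hx.symm (by omega)).symm
    · exact fun T hT g => (hA T hT g).symm
    · rw [← X.closed] at huv ⊢
      exact fun T hT g => (huv T hT g).symm
  have hmod := count_modEq_of_mem_Avar (by omega) hA x
  have hdvd := (Nat.modEq_iff_dvd' hlt.le).1 hmod
  have hle := Nat.le_of_dvd (by omega) hdvd
  have hcase : m ≤ v.letters.count x ∨ x ∉ u.letters ∧ x ∈ v.letters := by
    rcases Nat.eq_zero_or_pos (u.letters.count x) with h0 | h0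
    · exact Or.inr ⟨List.count_eq_zero.1 h0, List.count_pos_iff.1 (by omega)⟩
    · left; omega
  have hu : ∀ T ∈ modelsOf X.theory, ∀ (g : ℕ → T.carrier) (s : T.carrier),
      FreeSemigroup.lift g u * s = FreeSemigroup.lift g u :=
    fun T hT => lift_mul_eq_of_count (by omega) hX huv hcase hT
  have hv : ∀ T ∈ modelsOf X.theory, ∀ (g : ℕ → T.carrier) (s : T.carrier),
      FreeSemigroup.lift g v * s = FreeSemigroup.lift g v := by
    intro T hT g s
    rw [← show FreeSemigroup.lift g u = FreeSemigroup.lift g v from hT _ huv g, hu T hT]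
  calc FreeSemigroup.lift f u = FreeSemigroup.lift f u * FreeSemigroup.lift f v :=
        (lift_mul_eq_of_models_zeroReduced hu hS f _).symm
    _ = FreeSemigroup.lift f v := by
        rw [mul_comm, lift_mul_eq_of_models_zeroReduced hv hS]

/-- Let `m` and `n` be natural numbers with `m > 2` and `n ≥ m - 1`, and let `X` be a
commutative semigroup variety with `X ⊆ D m`.  Then `A n ∨ X = A n ∨ ZR X`. -/
theorem join_ZR_eq (m n : ℕ) (hm : 2 < m) (hn : m - 1 ≤ n)
    (X : ComVariety) (hX : X ≤ Dvar m) :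
    Avar n ⊔ X = Avar n ⊔ ZRv X := by
  refine le_antisymm (sup_le_sup_left (le_ZRv X) _) (sup_le le_sup_left ?_)
  refine (ZRv_le_zeroReducedHull X).trans fun i hi => ?_
  exact mem_zeroReducedHull_of_mem_of_mem_Avar hm hn hX
    ((le_sup_left : Avar n ≤ Avar n ⊔ X) hi) ((le_sup_right : X ≤ Avar n ⊔ X) hi)
end

section
/- Let m ≥ 0 and suppose C_m = M ∨ N, where M is a semigroup variety and N is a nil-variety. Then C_m = M (i.e., N ⊆ M). In particular, the variety C_m cannot be decomposed as a join of a proper subvariety with a nil-variety. -/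
open FirstOrder

/-! ### Evaluating words in commutative monoids -/

section Evaluation

theorem coe_lift {S : Type} [Semigroup S] (f : ℕ → S) (w : SGWord) :
    (FreeSemigroup.lift f w : WithOne S) = FreeSemigroup.lift (fun n => (f n : WithOne S)) w := by
  induction w using FreeSemigroup.recOnMul with
  | ih1 n => simp
  | ih2 n w _ ih => simp [ih]

theorem sgSatisfies_iff {S : Type} [Semigroup S] {i : SGId} :
    SGSatisfies S i ↔ ∀ f : ℕ → S, FreeSemigroup.lift (fun n => (f n : WithOne S)) i.1 =
      FreeSemigroup.lift (fun n => (f n : WithOne S)) i.2 := by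
  simp only [SGSatisfies, ← coe_lift, WithOne.coe_inj]

theorem SGSatisfies.symm {S : Type} [Semigroup S] {u v : SGWord} (h : SGSatisfies S (u, v)) :
    SGSatisfies S (v, u) :=
  fun f => (h f).symm

theorem lift_ltr {R : Type} [Semigroup R] (f : ℕ → R) (n : ℕ) :
    FreeSemigroup.lift f (ltr n) = f n :=
  FreeSemigroup.lift_of f n

theorem lift_wpow {R : Type} [Monoid R] (f : ℕ → R) (w : SGWord) (n : ℕ) :
    FreeSemigroup.lift f (wpow w (n + 1)) = FreeSemigroup.lift f w ^ (n + 1) := by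
  induction n with
  | zero => simp [wpow]
  | succ n ih => rw [wpow, map_mul, ih, ← pow_succ]

theorem coe_spow {S : Type} [Semigroup S] (a : S) (n : ℕ) :
    ((spow a (n + 1) : S) : WithOne S) = (a : WithOne S) ^ (n + 1) := by
  induction n with
  | zero => simp [spow]
  | succ n ih => rw [spow, WithOne.coe_mul, ih, ← pow_succ]

theorem WithOne.coe_pow_succ {R : Type} [Monoid R] (a : R) (n : ℕ) :
    ((a ^ (n + 1) : R) : WithOne R) = (a : WithOne R) ^ (n + 1) := by
  induction n with
  | zero => simp
  | succ n ih => rw [pow_succ, WithOne.coe_mul, ih, ← pow_succ]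

theorem lift_iterate_mul_ltr {R : Type} [Monoid R] (f : ℕ → R) (n : ℕ) (w : SGWord) (k : ℕ) :
    FreeSemigroup.lift f ((· * ltr n)^[k] w) = FreeSemigroup.lift f w * f n ^ k := by
  induction k with
  | zero => simp
  | succ k ih => rw [Function.iterate_succ_apply', map_mul, ih, lift_ltr, mul_assoc, ← pow_succ]

/-- The number of occurrences of each letter in a word. -/
noncomputable def content (w : SGWord) : ℕ →₀ ℕ :=
  (FreeSemigroup.lift (fun n => Multiplicative.ofAdd (Finsupp.single n 1)) w).toAdd

theorem content_of (n : ℕ) : content (FreeSemigroup.of n) = Finsupp.single n 1 := by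
  simp [content]

theorem content_mul (u v : SGWord) : content (u * v) = content u + content v := by
  simp [content]

theorem lift_eq_prod_content {R : Type} [CommMonoid R] (f : ℕ → R) (w : SGWord) :
    FreeSemigroup.lift f w = (content w).prod fun n k => f n ^ k := by
  induction w using FreeSemigroup.recOnMul with
  | ih1 n => simp [content_of]
  | ih2 n w ih₁ ih₂ =>
    rw [map_mul, ih₁, ih₂, content_mul, Finsupp.prod_add_index' (by simp) (by simp [pow_add])]

theorem exists_lift_update_const {R : Type} [CommMonoid R] (a b : R) (n : ℕ) (w : SGWord) :
    ∃ p, FreeSemigroup.lift (Function.update (fun _ => b) n a) w = a ^ content w n * b ^ p := by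
  induction w using FreeSemigroup.recOnMul with
  | ih1 k =>
    rcases eq_or_ne k n with rfl | hk
    · exact ⟨0, by simp [content_of]⟩
    · exact ⟨1, by simp [content_of, hk]⟩
  | ih2 k w ih₁ ih₂ =>
    obtain ⟨p, hp⟩ := ih₁
    obtain ⟨q, hq⟩ := ih₂
    refine ⟨p + q, ?_⟩
    rw [map_mul, hp, hq, content_mul, Finsupp.add_apply, pow_add, pow_add, mul_mul_mul_comm]

theorem pow_eq_pow_of_pow_eq_pow_succ {R : Type} [Monoid R] {a : R} {m : ℕ}
    (h : a ^ m = a ^ (m + 1)) {i : ℕ} (hi : m ≤ i) : a ^ i = a ^ m := by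
  induction i, hi using Nat.le_induction with
  | base => rfl
  | succ i _ ih => rw [pow_succ, ih, ← pow_succ, ← h]

theorem pow_mul_pow_eq_of_lt {R : Type} [CommMonoid R] {a b : R} {k i j p q : ℕ}
    (ha : a ^ (k + 1) = a ^ (k + 2)) (hb : b ^ (k + 1) = b ^ (k + 2))
    (h : a ^ i * b ^ p = a ^ j * b ^ q) (hij : i < j) (hik : i ≤ k) :
    b ^ (k + 1) * a ^ k = b ^ (k + 1) * a ^ (k + 1) :=
  calc b ^ (k + 1) * a ^ k
      = b ^ (k + 1 + p) * a ^ (i + (k - i)) := by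
        rw [pow_eq_pow_of_pow_eq_pow_succ hb (Nat.le_add_right _ _), Nat.add_sub_cancel' hik]
    _ = a ^ i * b ^ p * (b ^ (k + 1) * a ^ (k - i)) := by
        rw [pow_add _ (k + 1), pow_add _ i]
        ac_rfl
    _ = b ^ (k + 1 + q) * a ^ (j + (k - i)) := by
        rw [h, pow_add _ (k + 1), pow_add _ j]
        ac_rfl
    _ = b ^ (k + 1) * a ^ (k + 1) := by
        rw [pow_eq_pow_of_pow_eq_pow_succ hb (Nat.le_add_right _ _),
          pow_eq_pow_of_pow_eq_pow_succ ha (by omega)]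

theorem lift_eq_lift_of_content {R : Type} [CommMonoid R] {m : ℕ} {f : ℕ → R}
    (hf : ∀ n, f n ^ m = f n ^ (m + 1)) {u v : SGWord}
    (h : ∀ n, content u n = content v n ∨ m ≤ content u n ∧ m ≤ content v n) :
    FreeSemigroup.lift f u = FreeSemigroup.lift f v := by
  rw [lift_eq_prod_content, lift_eq_prod_content,
    Finsupp.prod_of_support_subset (content u) Finset.subset_union_left _ (by simp),
    Finsupp.prod_of_support_subset (content v) Finset.subset_union_right _ (by simp)]
  refine Finset.prod_congr rfl fun n _ => ?_
  rcases h n with h | ⟨hu, hv⟩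
  · rw [h]
  · rw [pow_eq_pow_of_pow_eq_pow_succ (hf n) hu, pow_eq_pow_of_pow_eq_pow_succ (hf n) hv]

end Evaluation

/-! ### Theories of varieties -/

theorem ComVariety.mem_theory_iff {V : ComVariety} {i : SGId} :
    i ∈ V.theory ↔ ∀ S ∈ modelsOf V.theory, SGSatisfies S.carrier i :=
  ⟨fun hi _ hS => hS i hi, fun h => V.closed ▸ h⟩

theorem ComVariety.le_comVar {V : ComVariety} {E : Set SGId} (h : E ⊆ V.theory) :
    V ≤ comVar E := fun i hi => by
  have := theoryOfClass_antitone (modelsOf_antitone h) hi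
  rwa [V.closed] at this

theorem mem_modelsOf_comVar {E : Set SGId} {S : ComSG} :
    S ∈ modelsOf (comVar E).theory ↔ S ∈ modelsOf E :=
  ⟨fun h i hi => h i (subset_theoryOfClass_modelsOf E hi), fun h _ hi => hi S h⟩

theorem mem_theory_sup {M N : ComVariety} {i : SGId} (hM : i ∈ M.theory) (hN : i ∈ N.theory) :
    i ∈ (M ⊔ N).theory := by
  have h : M ⊔ N ≤ comVar {i} :=
    sup_le (ComVariety.le_comVar (by simpa using hM)) (ComVariety.le_comVar (by simpa using hN))
  exact h (subset_theoryOfClass_modelsOf _ rfl)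

/-! ### The varieties `C m` -/

theorem theory_Cvar_zero : (Cvar 0).theory = Set.univ := by
  refine Set.eq_univ_of_forall fun i S hS f => ?_
  have h (a b : S.carrier) : a = b := by
    simpa [ltr] using hS _ rfl fun n => if n = 0 then a else b
  exact h _ _

theorem mem_modelsOf_Cvar_succ {k : ℕ} {S : ComSG} :
    S ∈ modelsOf (Cvar (k + 1)).theory ↔
      ∀ a : S.carrier, (a : WithOne S.carrier) ^ (k + 1) = (a : WithOne S.carrier) ^ (k + 2) := by
  rw [Cvar, mem_modelsOf_comVar]
  constructor
  · intro h a
    simpa only [lift_wpow, lift_ltr] using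
      sgSatisfies_iff.1 (h _ (Set.mem_insert _ _)) fun _ => a
  · rintro h i (rfl | rfl)
    · rw [sgSatisfies_iff]
      intro f
      simpa only [lift_wpow, lift_ltr] using h (f 0)
    · intro f
      simp [commId, mul_comm]

/-- The identity `yᵏ⁺¹xᵏ = yᵏ⁺¹xᵏ⁺¹`, with `x` the letter `0` and `y` the letter `1`. -/
def gapId (k : ℕ) : SGId :=
  ((· * ltr 0)^[k] (wpow (ltr 1) (k + 1)), (· * ltr 0)^[k + 1] (wpow (ltr 1) (k + 1)))

theorem sgSatisfies_gapId_iff {S : Type} [Semigroup S] {k : ℕ} :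
    SGSatisfies S (gapId k) ↔ ∀ a b : S,
      (b : WithOne S) ^ (k + 1) * (a : WithOne S) ^ k =
        (b : WithOne S) ^ (k + 1) * (a : WithOne S) ^ (k + 1) := by
  simp only [sgSatisfies_iff, gapId, lift_iterate_mul_ltr, lift_wpow, lift_ltr]
  exact ⟨fun h a b => by simpa using h fun n => if n = 0 then a else b, fun h f => h _ _⟩

theorem gapId_notMem_theory_Cvar (k : ℕ) : gapId k ∉ (Cvar (k + 1)).theory := by
  let P := Submonoid.powers (2 : ZMod (2 ^ (k + 1)))
  have two_pow : (2 : ZMod (2 ^ (k + 1))) ^ (k + 1) = 0 := by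
    exact_mod_cast ZMod.natCast_self (2 ^ (k + 1))
  have hP : (ComSG.mk P) ∈ modelsOf (Cvar (k + 1)).theory := by
    rw [mem_modelsOf_Cvar_succ]
    intro a
    rw [← WithOne.coe_pow_succ, ← WithOne.coe_pow_succ, WithOne.coe_inj, Subtype.ext_iff]
    obtain ⟨j, hj⟩ := a.2
    rw [SubmonoidClass.coe_pow, SubmonoidClass.coe_pow, ← hj]
    rcases j with _ | j
    · simp
    · simp [pow_right_comm _ (j + 1), two_pow, pow_succ _ (k + 1)]
  intro h
  let f (n : ℕ) : P := if n = 0 then ⟨2, Submonoid.mem_powers 2⟩ else 1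
  have hf : FreeSemigroup.lift f (gapId k).1 = FreeSemigroup.lift f (gapId k).2 :=
    ComVariety.mem_theory_iff.1 h (ComSG.mk P) hP f
  simp only [gapId, lift_iterate_mul_ltr, lift_wpow, lift_ltr] at hf
  have hpow : (2 : ZMod (2 ^ (k + 1))) ^ k = 2 ^ (k + 1) := by
    simpa [f, Subtype.ext_iff] using hf
  have hdvd : 2 ^ (k + 1) ∣ 2 ^ k := by
    rw [← ZMod.natCast_eq_zero_iff]
    push_cast
    rw [hpow, two_pow]
  exact absurd (Nat.le_of_dvd (by positivity) hdvd) (by simp [pow_succ])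

/-- If `S` satisfies `xᵏ⁺¹ = xᵏ⁺²` and an identity whose sides contain some letter a different
number of times, at most `k` in the first one, then it satisfies `yᵏ⁺¹xᵏ = yᵏ⁺¹xᵏ⁺¹`. -/
theorem sgSatisfies_gapId_of_content_lt {S : Type} [CommSemigroup S] {k : ℕ}
    (hS : ∀ a : S, (a : WithOne S) ^ (k + 1) = (a : WithOne S) ^ (k + 2)) {u v : SGWord}
    (h : SGSatisfies S (u, v)) {n : ℕ} (hlt : content u n < content v n) (hk : content u n ≤ k) :
    SGSatisfies S (gapId k) := by
  rw [sgSatisfies_gapId_iff]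
  intro a b
  have huv := sgSatisfies_iff.1 h (Function.update (fun _ => b) n a)
  have hupd : (fun l => (Function.update (fun _ => b) n a l : WithOne S)) =
      Function.update (fun _ => (b : WithOne S)) n a := by
    ext1 l
    rcases eq_or_ne l n with rfl | hl <;> simp [*]
  obtain ⟨p, hp⟩ := exists_lift_update_const (a : WithOne S) b n u
  obtain ⟨q, hq⟩ := exists_lift_update_const (a : WithOne S) b n v
  rw [hupd, hp, hq] at huv
  exact pow_mul_pow_eq_of_lt (hS a) (hS b) huv hlt hk

theorem sgSatisfies_gapId_of_isNilSG {S : Type} [CommSemigroup S] {k : ℕ}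
    (hS : ∀ a : S, (a : WithOne S) ^ (k + 1) = (a : WithOne S) ^ (k + 2)) (hnil : IsNilSG S) :
    SGSatisfies S (gapId k) := by
  obtain ⟨z, hz, hn⟩ := hnil
  have hz' (c : WithOne S) : (z : WithOne S) * c = z := by
    induction c with
    | one => simp
    | coe c => rw [← WithOne.coe_mul, (hz c).1]
  have hpow (b : S) : (b : WithOne S) ^ (k + 1) = z := by
    obtain ⟨n, hn, hb⟩ := hn b
    obtain ⟨n, rfl⟩ := Nat.exists_eq_add_of_le' hn
    rw [← pow_eq_pow_of_pow_eq_pow_succ (hS b) (Nat.le_add_left (k + 1) (n + 1)), pow_add,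
      ← coe_spow, hb, hz']
  rw [sgSatisfies_gapId_iff]
  intro a b
  rw [hpow b, hz', hz']

theorem gapId_mem_theory_of_lt {M : ComVariety} {k : ℕ} (hM : M ≤ Cvar (k + 1)) {u v : SGWord}
    (h : ∀ S ∈ modelsOf M.theory, SGSatisfies S.carrier (u, v)) {n : ℕ}
    (hlt : content u n < content v n) (hk : content u n ≤ k) : gapId k ∈ M.theory :=
  ComVariety.mem_theory_iff.2 fun S hS => sgSatisfies_gapId_of_content_lt
    (mem_modelsOf_Cvar_succ.1 (modelsOf_antitone hM hS)) (h S hS) hlt hk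

/-- A proper subvariety of `C (k + 1)` satisfies `yᵏ⁺¹xᵏ = yᵏ⁺¹xᵏ⁺¹`. -/
theorem Cvar_le_of_gapId_notMem {M : ComVariety} {k : ℕ} (hM : M ≤ Cvar (k + 1))
    (h : gapId k ∉ M.theory) : Cvar (k + 1) ≤ M := by
  rintro ⟨u, v⟩ huv
  rw [ComVariety.mem_theory_iff] at huv ⊢
  intro S hS
  rw [mem_modelsOf_Cvar_succ] at hS
  rw [sgSatisfies_iff]
  intro f
  refine lift_eq_lift_of_content (fun n => hS (f n)) fun n => ?_
  by_contra! hn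
  dsimp only at hn
  rcases lt_or_gt_of_ne hn.1 with hlt | hlt
  · exact h (gapId_mem_theory_of_lt hM huv hlt (by omega))
  · exact h (gapId_mem_theory_of_lt hM (fun S hS => (huv S hS).symm) hlt (by omega))

/-- Let `m ≥ 0` and suppose `C m = M ∨ N` where `M` is a (commutative semigroup)
variety and `N` is a nil-variety.  Then `N ⊆ M` and hence `C m = M`; in particular,
`C m` cannot be decomposed as a join of a proper subvariety with a nil-variety. -/
theorem Cvar_join_nil (m : ℕ) (M N : ComVariety) (hN : IsNilVariety N)
    (h : Cvar m = M ⊔ N) :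
    N ≤ M ∧ Cvar m = M := by
  suffices hle : Cvar m ≤ M by
    have hMN : M ⊔ N ≤ M := h ▸ hle
    exact ⟨le_sup_right.trans hMN, hle.antisymm (h ▸ le_sup_left)⟩
  have hM : M ≤ Cvar m := h ▸ le_sup_left
  have hN' : N ≤ Cvar m := h ▸ le_sup_right
  cases m with
  | zero => exact fun i _ => theory_Cvar_zero ▸ Set.mem_univ i
  | succ k =>
    refine Cvar_le_of_gapId_notMem hM fun hgap => gapId_notMem_theory_Cvar k ?_
    rw [h]
    exact mem_theory_sup hgap (ComVariety.mem_theory_iff.2 fun S hS =>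
      sgSatisfies_gapId_of_isNilSG (mem_modelsOf_Cvar_succ.1 (modelsOf_antitone hN' hS)) (hN S hS))
end
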